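/- Let n ≥ 1, p ≥ 4 and t ≥ 1 be integers, and let D ⊆ {0,…,p−1}^n be a digit set with #D = p^n − t > 0. Let g(ξ) = (1/#D) Σ_{d∈D} e^{−2πi⟨d,ξ⟩} and f(θ) = Σ_{i∈{0,…,p−1}^n} |g((i+θ)/p)| for θ ∈ [0,1]^n. Then sup_{θ∈[0,1]^n} f(θ) ≤ (t·p^n + (2p·log p)^n)/(p^n − t), and consequently dim_{l¹} λ_{p,D} ≥ n − log( (t·p^n + (2p·log p)^n)/(p^n − t) ) / log p. -/

import Mathlib

open MeasureTheory Metric Filter Set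
open scoped ENNReal NNReal Real Topology

noncomputable section

/-- The Fourier transform of a measure on ℝⁿ: `μ̂(ξ) = ∫ e^{-2πi⟨x,ξ⟩} dμ(x)`. -/
def mft {n : ℕ} (μ : Measure (EuclideanSpace ℝ (Fin n))) (ξ : EuclideanSpace ℝ (Fin n)) : ℂ :=
  ∫ x, Complex.exp ((((-(2 * Real.pi * (inner ℝ x ξ : ℝ))) : ℝ) : ℂ) * Complex.I) ∂μ

/-- A lattice point `ξ ∈ ℤⁿ` viewed as an element of ℝⁿ. -/
def lat {n : ℕ} (ξ : Fin n → ℤ) : EuclideanSpace ℝ (Fin n) := WithLp.toLp 2 fun i => (ξ i : ℝ)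

/-- The box `[0,1]ⁿ`. -/
def box01 (n : ℕ) : Set (EuclideanSpace ℝ (Fin n)) := {θ | ∀ i, θ i ∈ Set.Icc (0 : ℝ) 1}

/-- `g(ξ) = (1/#D) Σ_{d ∈ D} e^{-2πi⟨d,ξ⟩}`. -/
def gD {n : ℕ} (D : Finset (Fin n → ℕ)) (ξ : EuclideanSpace ℝ (Fin n)) : ℂ :=
  (D.card : ℂ)⁻¹ * ∑ d ∈ D,
    Complex.exp ((((-(2 * Real.pi * ∑ i, (d i : ℝ) * ξ i)) : ℝ) : ℂ) * Complex.I)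

/-- A digit vector `i ∈ {0,…,p-1}ⁿ` viewed as an element of ℝⁿ. -/
def digv {n p : ℕ} (i : Fin n → Fin p) : EuclideanSpace ℝ (Fin n) := WithLp.toLp 2 fun j => ((i j : ℕ) : ℝ)

/-- `f(θ) = Σ_{i ∈ {0,…,p-1}ⁿ} |g((i+θ)/p)|`. -/
def fD (n p : ℕ) (D : Finset (Fin n → ℕ)) (θ : EuclideanSpace ℝ (Fin n)) : ℝ :=
  ∑ i : Fin n → Fin p, ‖gD D ((p : ℝ)⁻¹ • (digv i + θ))‖

/-- Sum of `|μ̂(ξ+θ)|` over lattice points `|ξ| ≤ R` (Euclidean norm). -/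
def latSum {n : ℕ} (μ : Measure (EuclideanSpace ℝ (Fin n))) (R : ℝ)
    (θ : EuclideanSpace ℝ (Fin n)) : ℝ :=
  ∑' ξ : Fin n → ℤ, if ‖lat ξ‖ ≤ R then ‖mft μ (lat ξ + θ)‖ else 0

/-- The Fourier `l¹`-dimension of a measure on ℝⁿ. -/
def diml1 {n : ℕ} (μ : Measure (EuclideanSpace ℝ (Fin n))) : ℝ :=
  sSup {s : ℝ | 0 < s ∧ ∃ C : ℝ, 0 < C ∧ ∀ R : ℝ, 1 ≤ R → ∀ θ ∈ box01 n,
    latSum μ R θ ≤ C * R ^ ((n : ℝ) - s)}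

/-- the additive character `e(-x)` -/
def ee (x : ℝ) : ℂ := Complex.exp ((((-(2 * Real.pi * x)) : ℝ) : ℂ) * Complex.I)

lemma ee_norm (x : ℝ) : ‖ee x‖ = 1 := by
  unfold ee; exact Complex.norm_exp_ofReal_mul_I _

lemma ee_add (x y : ℝ) : ee (x + y) = ee x * ee y := by
  unfold ee; rw [← Complex.exp_add]; congr 1; push_cast; ring

lemma ee_zero : ee 0 = 1 := by simp [ee]

lemma ee_int (m : ℤ) : ee m = 1 := by
  unfold ee
  rw [Complex.exp_eq_one_iff]
  exact ⟨-m, by push_cast; ring⟩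

lemma ee_sum {ι : Type*} (s : Finset ι) (f : ι → ℝ) : ee (∑ i ∈ s, f i) = ∏ i ∈ s, ee (f i) := by
  classical
  induction s using Finset.induction_on with
  | empty => simp [ee_zero]
  | insert a s ha ih => rw [Finset.sum_insert ha, Finset.prod_insert ha, ee_add, ih]

lemma ee_nat_mul (k : ℕ) (x : ℝ) : ee (k * x) = ee x ^ k := by
  unfold ee; rw [← Complex.exp_nat_mul]; congr 1; push_cast; ring

lemma ee_neg (x : ℝ) : ee (-x) = (starRingEnd ℂ) (ee x) := by
  unfold ee; rw [← Complex.exp_conj]; congr 1; simp [Complex.conj_ofNat]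

lemma gD_eq {n : ℕ} (D : Finset (Fin n → ℕ)) (ξ : EuclideanSpace ℝ (Fin n)) :
    gD D ξ = (D.card : ℂ)⁻¹ * ∑ d ∈ D, ee (∑ i, (d i : ℝ) * ξ i) := rfl

/-- one-dimensional kernel -/
def KK (p : ℕ) (x : ℝ) : ℝ := ‖∑ k ∈ Finset.range p, ee (k * x)‖

lemma KK_nonneg (p : ℕ) (x : ℝ) : 0 ≤ KK p x := norm_nonneg _

lemma KK_le (p : ℕ) (x : ℝ) : KK p x ≤ p := by
  unfold KK
  refine (norm_sum_le _ _).trans ?_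
  simp [ee_norm]

lemma KK_mul_sin (p : ℕ) (x : ℝ) : KK p x * |Real.sin (π * x)| ≤ 1 := by
  have h1 : (∑ k ∈ Finset.range p, ee (k * x)) * (ee x - 1) = ee x ^ p - 1 := by
    simp_rw [ee_nat_mul]; exact geom_sum_mul _ _
  have h2 : ‖ee x - 1‖ = 2 * |Real.sin (π * x)| := by
    have := Complex.norm_exp_I_mul_ofReal_sub_one (-(2 * π * x))
    unfold ee
    rw [mul_comm, this, show -(2 * π * x) / 2 = -(π * x) by ring, Real.sin_neg]
    simp
  have h3 : ‖ee x ^ p - 1‖ ≤ 2 := by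
    refine (norm_sub_le _ _).trans ?_
    simp [ee_norm]; norm_num
  rw [← h1, norm_mul, h2] at h3
  unfold KK; linarith

lemma sin_lower (x : ℝ) (h0 : 0 ≤ x) (h1 : x ≤ 1) : 2 * min x (1 - x) ≤ Real.sin (π * x) := by
  have hpi := Real.pi_pos
  rcases le_total x (1/2) with h | h
  · have := Real.mul_le_sin (x := π * x) (by positivity) (by nlinarith)
    have e : 2 / π * (π * x) = 2 * x := by field_simp
    rw [e] at this
    exact le_trans (by gcongr; exact min_le_left _ _) this
  · have := Real.mul_le_sin (x := π * (1 - x)) (by nlinarith) (by nlinarith)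
    have e : 2 / π * (π * (1 - x)) = 2 * (1 - x) := by field_simp
    rw [e, show π * (1 - x) = π - π * x by ring, Real.sin_pi_sub] at this
    exact le_trans (by gcongr; exact min_le_right _ _) this

lemma KK_bound (p a b : ℕ) (θ : ℝ) (hθ : θ ∈ Set.Icc (0:ℝ) 1) (ha : 1 ≤ a) (hb : 1 ≤ b)
    (hp : a + b + 1 = p) :
    KK p ((a + θ) / p) ≤ p / 2 * ((a : ℝ)⁻¹ + (b : ℝ)⁻¹) := by
  obtain ⟨t0, t1⟩ := hθ
  have ha' : (1:ℝ) ≤ a := by exact_mod_cast ha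
  have hb' : (1:ℝ) ≤ b := by exact_mod_cast hb
  have hp' : (a:ℝ) + b + 1 = p := by exact_mod_cast hp
  have hpp : (0:ℝ) < p := by linarith
  set x := (a + θ) / p with hx
  have hxa : (a:ℝ) / p ≤ x := by rw [hx]; gcongr; linarith
  have hxb : (b:ℝ) / p ≤ 1 - x := by
    have : 1 - x = (p - (a + θ)) / p := by rw [hx]; field_simp
    rw [this]; gcongr; linarith
  have pa : 0 < (a:ℝ) / p := by positivity
  have pb : 0 < (b:ℝ) / p := by positivity
  have hs := sin_lower x (by linarith) (by linarith)
  have hm := KK_mul_sin p x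
  have hk := KK_nonneg p x
  have hs' : 0 < min ((a:ℝ) / p) (b / p) := lt_min pa pb
  have hs2 : min ((a:ℝ) / p) (b / p) ≤ min x (1 - x) := min_le_min hxa hxb
  have h4 : KK p x * (2 * min ((a:ℝ) / p) (b / p)) ≤ 1 := by
    refine le_trans ?_ hm
    gcongr
    exact (by linarith : _ ≤ Real.sin (π * x)).trans (le_abs_self _)
  have h5 : KK p x ≤ 1 / (2 * min ((a:ℝ) / p) (b / p)) := by
    rw [le_div_iff₀ (by positivity)]; exact h4
  refine h5.trans ?_
  rcases min_choice ((a:ℝ) / p) (b / p) with h | h <;> rw [h]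
  · have : 1 / (2 * ((a:ℝ) / p)) = p / 2 * (a:ℝ)⁻¹ := by field_simp
    rw [this]; gcongr; simp
  · have : 1 / (2 * ((b:ℝ) / p)) = p / 2 * (b:ℝ)⁻¹ := by field_simp
    rw [this]; gcongr; simp

lemma KK_sum_large (p : ℕ) (hp : 21 ≤ p) (θ : ℝ) (hθ : θ ∈ Set.Icc (0:ℝ) 1) :
    ∑ a ∈ Finset.range p, KK p ((a + θ) / p) ≤ 2 * p * Real.log p := by
  obtain ⟨q, rfl⟩ : ∃ q, p = q + 2 := ⟨p - 2, by omega⟩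
  rw [Finset.sum_range_succ, Finset.sum_range_succ']
  have h1 : ∑ a ∈ Finset.range q, KK (q+2) (((a + 1 : ℕ) + θ) / (q + 2 : ℕ)) ≤
      ∑ a ∈ Finset.range q, ((q + 2 : ℕ) : ℝ) / 2 * (((a + 1 : ℕ) : ℝ)⁻¹ + ((q - 1 - a + 1 : ℕ) : ℝ)⁻¹) := by
    apply Finset.sum_le_sum
    intro a ha
    have := Finset.mem_range.1 ha
    exact KK_bound _ _ _ _ hθ (by omega) (by omega) (by omega)
  rw [← Finset.mul_sum, Finset.sum_add_distrib,
    Finset.sum_range_reflect (fun a => (((a + 1 : ℕ) : ℝ)⁻¹)) q] at h1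
  have h2 := harmonic_le_one_add_log q
  have h3 : ((harmonic q : ℚ) : ℝ) = ∑ a ∈ Finset.range q, (((a + 1 : ℕ) : ℝ)⁻¹) := by
    unfold harmonic; push_cast; rfl
  rw [← h3] at h1
  have k0 := KK_le (q+2) (((0 : ℕ) + θ) / (q + 2 : ℕ))
  have k1 := KK_le (q+2) (((q + 1 : ℕ) + θ) / (q + 2 : ℕ))
  have hl : Real.log q ≤ Real.log (q + 2 : ℕ) := by
    apply Real.log_le_log
    · exact_mod_cast (by omega : 0 < q)
    · push_cast; linarith
  have h3l : 3 ≤ Real.log (q + 2 : ℕ) := by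
    rw [Real.le_log_iff_exp_le (by positivity)]
    have e1 := Real.exp_one_lt_d9
    have : Real.exp 3 = Real.exp 1 ^ 3 := by rw [← Real.exp_nat_mul]; norm_num
    rw [this]
    have h21 : (21:ℝ) ≤ (q + 2 : ℕ) := by exact_mod_cast hp
    have := pow_le_pow_left₀ (Real.exp_pos 1).le e1.le 3
    norm_num at this ⊢
    push_cast at h21
    linarith
  have hq : (0:ℝ) ≤ ((q + 2 : ℕ):ℝ) := by positivity
  nlinarith [mul_le_mul_of_nonneg_left (show ((harmonic q : ℚ) : ℝ) + 2 ≤ 2 * Real.log (q + 2 : ℕ) by linarith) hq]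

lemma KK_parseval (p : ℕ) (hp : 0 < p) (θ : ℝ) :
    ∑ a ∈ Finset.range p, KK p ((a + θ) / p) ^ 2 = (p:ℝ) ^ 2 := by
  have hpC : (p:ℝ) ≠ 0 := by positivity
  have key : ∀ k ∈ Finset.range p, ∀ l ∈ Finset.range p,
      ∑ a ∈ Finset.range p, ee (k * ((a + θ) / p)) * (starRingEnd ℂ) (ee (l * ((a + θ) / p)))
        = if k = l then (p:ℂ) else 0 := by
    intro k hk l hl
    have e1 : ∀ a : ℕ, ee (k * ((a + θ) / p)) * (starRingEnd ℂ) (ee (l * ((a + θ) / p)))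
        = ee (((k:ℝ) - l) * θ / p) * (ee (((k:ℝ) - l) / p)) ^ a := by
      intro a
      rw [← ee_neg, ← ee_add, ← ee_nat_mul, ← ee_add]
      congr 1; field_simp; ring
    simp_rw [e1]
    rw [← Finset.mul_sum]
    split_ifs with h
    · subst h; simp [ee_zero]
    · have hne : ee (((k:ℝ) - l) / p) ≠ 1 := by
        intro h1
        have hz := Complex.isPrimitiveRoot_exp p hp.ne'
        have h2 : ee ((k:ℝ) / p) = ee ((l:ℝ) / p) := by
          have : (k:ℝ) / p = ((k:ℝ) - l) / p + l / p := by ring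
          rw [this, ee_add, h1, one_mul]
        have h3 : ∀ m : ℕ, (Complex.exp (2 * π * Complex.I / p)) ^ m = (starRingEnd ℂ) (ee ((m:ℝ) / p)) := by
          intro m
          rw [← ee_neg]; unfold ee
          rw [← Complex.exp_nat_mul]; congr 1; push_cast; ring
        apply h
        apply hz.pow_inj (Finset.mem_range.1 hk) (Finset.mem_range.1 hl)
        rw [h3, h3, h2]
      have hpow : ee (((k:ℝ) - l) / p) ^ p = 1 := by
        rw [← ee_nat_mul, ← ee_int (k - l)]
        congr 1; push_cast; field_simp
      have := geom_sum_mul (ee (((k:ℝ) - l) / p)) p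
      rw [hpow, sub_self] at this
      rcases mul_eq_zero.1 this with h | h
      · rw [h, mul_zero]
      · exact absurd (sub_eq_zero.1 h) hne
  have hC : ((∑ a ∈ Finset.range p, KK p ((a + θ) / p) ^ 2 : ℝ) : ℂ) = (p:ℂ)^2 := by
    push_cast
    have : ∀ a ∈ Finset.range p, ((KK p ((a + θ) / p) : ℝ) : ℂ) ^ 2 =
        ∑ k ∈ Finset.range p, ∑ l ∈ Finset.range p,
          ee (k * ((a + θ) / p)) * (starRingEnd ℂ) (ee (l * ((a + θ) / p))) := by
      intro a _
      unfold KK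
      rw [← Complex.mul_conj', map_sum, Finset.sum_mul_sum]
    rw [Finset.sum_congr rfl this, Finset.sum_comm]
    rw [Finset.sum_congr rfl (fun k hk => by
      rw [Finset.sum_comm, Finset.sum_congr rfl (fun l hl => key k hk l hl)])]
    rw [Finset.sum_congr rfl (fun k hk => by
      rw [Finset.sum_ite_eq, if_pos hk])]
    simp [sq]
  exact_mod_cast hC

lemma KK_sum_small (p : ℕ) (hp : 4 ≤ p) (hp' : p ≤ 20) (θ : ℝ) :
    ∑ a ∈ Finset.range p, KK p ((a + θ) / p) ≤ 2 * p * Real.log p := by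
  have h := sq_sum_le_card_mul_sum_sq (s := Finset.range p) (f := fun a => KK p ((a + θ) / p))
  rw [KK_parseval p (by omega), Finset.card_range] at h
  have hpp : (4:ℝ) ≤ p := by exact_mod_cast hp
  have l2 := Real.log_two_gt_d9
  have hlog : (p:ℝ) ≤ (2 * Real.log p) ^ 2 ∧ 0 ≤ Real.log p := by
    refine ⟨?_, Real.log_nonneg (by linarith)⟩
    have H : ∀ k : ℕ, 2 ^ k ≤ p → (k:ℝ) * Real.log 2 ≤ Real.log p := by
      intro k hk
      rw [← Real.log_pow]
      apply Real.log_le_log (by positivity)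
      exact_mod_cast hk
    rcases le_or_gt p 7 with h7 | h7
    · have := H 2 (by omega)
      have h7' : (p:ℝ) ≤ 7 := by exact_mod_cast h7
      push_cast at this
      nlinarith
    · have h7' : (p:ℝ) ≤ 20 := by exact_mod_cast hp'
      rcases le_or_gt p 15 with h8 | h8
      · have := H 3 (by omega)
        have h7' : (p:ℝ) ≤ 15 := by exact_mod_cast h8
        push_cast at this
        nlinarith
      · have := H 4 (by omega)
        push_cast at this
        nlinarith
  refine (sq_le_sq₀ (Finset.sum_nonneg fun _ _ => KK_nonneg _ _) (by have := hlog.2; positivity)).1 ?_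
  calc _ ≤ (p:ℝ) * p ^ 2 := h
    _ ≤ (2 * Real.log p) ^ 2 * p ^ 2 := by gcongr; exact hlog.1
    _ = _ := by ring

lemma KK_sum (p : ℕ) (hp : 4 ≤ p) (θ : ℝ) (hθ : θ ∈ Set.Icc (0:ℝ) 1) :
    ∑ a ∈ Finset.range p, KK p ((a + θ) / p) ≤ 2 * p * Real.log p := by
  rcases le_or_gt p 20 with h | h
  · exact KK_sum_small p hp h θ
  · exact KK_sum_large p h θ hθ

lemma gD_bound (n p t : ℕ) (D : Finset (Fin n → ℕ)) (hDdig : ∀ d ∈ D, ∀ i, d i < p)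
    (hcard : D.card + t = p ^ n) (ξ : EuclideanSpace ℝ (Fin n)) :
    ‖gD D ξ‖ ≤ (D.card : ℝ)⁻¹ * (t + ∏ i, KK p (ξ i)) := by
  classical
  set E := Fintype.piFinset (fun _ : Fin n => Finset.range p) with hE
  have hsub : D ⊆ E := by
    intro d hd
    rw [hE, Fintype.mem_piFinset]
    intro i; exact Finset.mem_range.2 (hDdig d hd i)
  have hEc : E.card = p ^ n := by simp [hE]
  have hdc : (E \ D).card = t := by
    rw [Finset.card_sdiff_of_subset hsub]; omega
  have hs := Finset.sum_sdiff hsub (f := fun d => ee (∑ i, (d i : ℝ) * ξ i))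
  have hprod : ∑ d ∈ E, ee (∑ i, (d i : ℝ) * ξ i) = ∏ i, ∑ k ∈ Finset.range p, ee (k * ξ i) := by
    rw [Finset.prod_univ_sum]
    exact Finset.sum_congr rfl fun d _ => ee_sum _ _
  rw [gD_eq, norm_mul, norm_inv, Complex.norm_natCast]
  gcongr
  rw [eq_sub_of_add_eq' hs, hprod]
  refine (norm_sub_le _ _).trans ?_
  rw [add_comm]
  gcongr
  · refine (norm_sum_le _ _).trans ?_
    simp [ee_norm, hdc]
  · rw [norm_prod]; rfl

lemma fD_bound (n p t : ℕ) (hp : 4 ≤ p)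
    (D : Finset (Fin n → ℕ)) (hDdig : ∀ d ∈ D, ∀ i, d i < p)
    (hcard : D.card + t = p ^ n) 
    (θ : EuclideanSpace ℝ (Fin n)) (hθ : θ ∈ box01 n) :
    fD n p D θ ≤ ((t : ℝ) * (p : ℝ) ^ n + (2 * p * Real.log p) ^ n) / ((p : ℝ) ^ n - t) := by
  have hc : (p : ℝ) ^ n - t = D.card := by
    rw [sub_eq_iff_eq_add]; exact_mod_cast hcard.symm
  rw [hc, div_eq_inv_mul]
  unfold fD
  refine (Finset.sum_le_sum fun i _ => gD_bound n p t D hDdig hcard _).trans ?_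
  rw [← Finset.mul_sum, Finset.sum_add_distrib]
  gcongr
  · simp [mul_comm]
  · have : ∏ j : Fin n, ∑ a : Fin p, KK p (((a:ℕ) + θ j) / p) ≤ (2 * p * Real.log p) ^ n := by
      calc _ ≤ ∏ j : Fin n, (2 * p * Real.log p) := by
            apply Finset.prod_le_prod
            · intro i _; exact Finset.sum_nonneg fun _ _ => KK_nonneg _ _
            · intro j _
              rw [Fin.sum_univ_eq_sum_range (fun a => KK p ((a + θ j) / p))]
              exact KK_sum p hp _ (hθ j)
        _ = _ := by simp
    rw [Finset.prod_univ_sum, Fintype.piFinset_univ] at this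
    refine le_trans (le_of_eq ?_) this
    refine Finset.sum_congr rfl fun i _ => Finset.prod_congr rfl fun j _ => ?_
    simp [digv, div_eq_inv_mul, mul_add]

lemma gD_norm_le_one {n : ℕ} (D : Finset (Fin n → ℕ)) (ξ : EuclideanSpace ℝ (Fin n)) :
    ‖gD D ξ‖ ≤ 1 := by
  rw [gD_eq, norm_mul, norm_inv, Complex.norm_natCast]
  have : ‖∑ d ∈ D, ee (∑ i, (d i : ℝ) * ξ i)‖ ≤ D.card := by
    refine (norm_sum_le _ _).trans ?_
    simp [ee_norm]
  exact (mul_le_mul_of_nonneg_left this (by positivity)).trans inv_mul_le_one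

lemma gD_periodic {n : ℕ} (D : Finset (Fin n → ℕ)) (ξ : EuclideanSpace ℝ (Fin n))
    (m : Fin n → ℤ) : gD D (ξ + lat m) = gD D ξ := by
  rw [gD_eq, gD_eq]
  congr 1
  refine Finset.sum_congr rfl fun d _ => ?_
  have : ∑ i, (d i : ℝ) * (ξ + lat m) i = ∑ i, (d i : ℝ) * ξ i + ((∑ i, (d i : ℤ) * m i : ℤ) : ℝ) := by
    push_cast
    rw [← Finset.sum_add_distrib]
    refine Finset.sum_congr rfl fun i _ => ?_
    simp [lat, mul_add]
  rw [this, ee_add, ee_int, mul_one]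

lemma ee_sub_one (x : ℝ) : ‖ee x - 1‖ ≤ 2 * π * |x| := by
  have := Real.norm_exp_I_mul_ofReal_sub_one_le (x := -(2 * π * x))
  unfold ee
  rw [mul_comm]
  refine this.trans (le_of_eq ?_)
  rw [Real.norm_eq_abs, abs_neg, abs_mul, abs_of_pos Real.two_pi_pos]

lemma gD_sub_one {n : ℕ} (D : Finset (Fin n → ℕ)) (hD : D.Nonempty)
    (ξ : EuclideanSpace ℝ (Fin n)) (c : ℝ) :
    ‖gD D (c • ξ) - 1‖ ≤ |c| * ((D.card : ℝ)⁻¹ * ∑ d ∈ D, 2 * π * |∑ i, (d i : ℝ) * ξ i|) := by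
  have hc : (D.card : ℂ) ≠ 0 := by exact_mod_cast hD.card_ne_zero
  have : gD D (c • ξ) - 1 = (D.card : ℂ)⁻¹ * ∑ d ∈ D, (ee (∑ i, (d i : ℝ) * (c • ξ) i) - 1) := by
    rw [gD_eq, Finset.sum_sub_distrib]
    simp [mul_sub, hc]
  rw [this, norm_mul, norm_inv, Complex.norm_natCast, mul_left_comm]
  gcongr
  rw [Finset.mul_sum]
  refine (norm_sum_le _ _).trans (Finset.sum_le_sum fun d _ => ?_)
  refine (ee_sub_one _).trans (le_of_eq ?_)
  have : ∑ i, (d i : ℝ) * (c • ξ) i = c * ∑ i, (d i : ℝ) * ξ i := by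
    rw [Finset.mul_sum]
    refine Finset.sum_congr rfl fun i _ => ?_
    simp; ring
  rw [this, abs_mul]; ring

lemma gD_multipliable {n p : ℕ} (hp : 4 ≤ p) (D : Finset (Fin n → ℕ)) (hD : D.Nonempty)
    (ξ : EuclideanSpace ℝ (Fin n)) :
    Multipliable fun j : ℕ => gD D (((p : ℝ) ^ (j + 1))⁻¹ • ξ) := by
  have hp' : (4:ℝ) ≤ p := by exact_mod_cast hp
  have : Summable fun j : ℕ => ‖gD D (((p : ℝ) ^ (j + 1))⁻¹ • ξ) - 1‖ := by
    refine Summable.of_nonneg_of_le (fun _ => norm_nonneg _) (fun j => gD_sub_one D hD ξ _) ?_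
    apply Summable.mul_right
    have h : Summable fun j : ℕ => ((p:ℝ)⁻¹) ^ j :=
      summable_geometric_of_lt_one (by positivity) (inv_lt_one_of_one_lt₀ (by linarith))
    refine ((summable_nat_add_iff 1).2 h).congr fun j => ?_
    rw [abs_of_nonneg (by positivity), inv_pow]
  have h2 := multipliable_one_add_of_summable this
  simpa using h2

lemma mft_bound {n p : ℕ} (hp : 4 ≤ p) (D : Finset (Fin n → ℕ)) (hD : D.Nonempty)
    (ξ : EuclideanSpace ℝ (Fin n)) (k : ℕ) :
    ‖∏' j : ℕ, gD D (((p : ℝ) ^ (j + 1))⁻¹ • ξ)‖ ≤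
      ∏ j ∈ Finset.range k, ‖gD D (((p : ℝ) ^ (j + 1))⁻¹ • ξ)‖ := by
  have h := ((gD_multipliable hp D hD ξ).hasProd.tendsto_prod_nat).norm
  refine le_of_tendsto h ?_
  filter_upwards [eventually_ge_atTop k] with m hm
  rw [norm_prod]
  exact Finset.prod_le_prod_of_subset_of_le_one (Finset.range_mono hm)
    (fun _ _ => norm_nonneg _) (fun _ _ _ => gD_norm_le_one D _)

lemma T_bound {n p : ℕ} (hp : 4 ≤ p) (D : Finset (Fin n → ℕ)) (B : ℝ) (hB : 0 ≤ B)
    (hf : ∀ θ ∈ box01 n, fD n p D θ ≤ B) (k : ℕ) :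
    ∀ θ ∈ box01 n, ∑ ξ : Fin n → Fin (p ^ k),
      ∏ j ∈ Finset.range k, ‖gD D (((p : ℝ) ^ (j + 1))⁻¹ • (digv ξ + θ))‖ ≤ B ^ k := by
  have hp0 : (4:ℝ) ≤ p := by exact_mod_cast hp
  have hpp : (p:ℝ) ≠ 0 := by positivity
  induction k with
  | zero =>
    intro θ _
    have : Fintype.card (Fin n → Fin (p ^ 0)) = 1 := by simp
    rw [Finset.range_zero]
    simp only [Finset.prod_empty]
    rw [Finset.sum_const, Finset.card_univ, this]
    simp
  | succ k ih =>
    intro θ hθ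
    let e : (Fin n → Fin (p ^ k)) × (Fin n → Fin p) ≃ (Fin n → Fin (p ^ (k + 1))) :=
      (Equiv.arrowProdEquivProdArrow (Fin n) (fun _ => Fin (p ^ k)) (fun _ => Fin p)).symm.trans
        (Equiv.piCongrRight fun _ => finProdFinEquiv)
    have he : ∀ η i, digv (e (η, i)) = digv i + (p:ℝ) • digv η := by
      intro η i
      ext j
      have hv : ((e (η, i) j : Fin (p ^ (k + 1))) : ℕ) = (i j : ℕ) + p * (η j : ℕ) := rfl
      simp [digv, hv]
    rw [← e.sum_comp, Fintype.sum_prod_type_right]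
    have hbox : ∀ i : Fin n → Fin p, (p:ℝ)⁻¹ • (digv i + θ) ∈ box01 n := by
      intro i j
      have h1 := hθ j
      have h2 : (((i j : ℕ) : ℝ)) + 1 ≤ p := by exact_mod_cast (i j).2
      have : ((p:ℝ)⁻¹ • (digv i + θ)) j = (((i j : ℕ) : ℝ) + θ j) / p := by
        simp [digv, div_eq_inv_mul, mul_add]
      rw [this]
      constructor
      · have := h1.1; positivity
      · rw [div_le_one (by positivity)]; linarith [h1.2]
    have hterm : ∀ i η, ∏ j ∈ Finset.range (k+1), ‖gD D (((p : ℝ) ^ (j + 1))⁻¹ • (digv (e (η, i)) + θ))‖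
        = ‖gD D ((p:ℝ)⁻¹ • (digv i + θ))‖ * ∏ j ∈ Finset.range k,
          ‖gD D (((p : ℝ) ^ (j + 1))⁻¹ • (digv η + (p:ℝ)⁻¹ • (digv i + θ)))‖ := by
      intro i η
      rw [Finset.prod_range_succ', mul_comm, he]
      congr 1
      · have : ((p:ℝ) ^ (0+1))⁻¹ • (digv i + (p:ℝ) • digv η + θ) =
            (p:ℝ)⁻¹ • (digv i + θ) + lat (fun j => ((η j : ℕ) : ℤ)) := by
          ext j
          simp [digv, lat]
          field_simp
          ring
        rw [this, gD_periodic]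
      · refine Finset.prod_congr rfl fun j _ => ?_
        congr 2
        ext j
        simp [digv]
        field_simp
        ring
    calc _ = ∑ i : Fin n → Fin p, ‖gD D ((p:ℝ)⁻¹ • (digv i + θ))‖ * ∑ η : Fin n → Fin (p ^ k),
          ∏ j ∈ Finset.range k,
          ‖gD D (((p : ℝ) ^ (j + 1))⁻¹ • (digv η + (p:ℝ)⁻¹ • (digv i + θ)))‖ := by
          refine Finset.sum_congr rfl fun i _ => ?_
          rw [Finset.mul_sum]
          exact Finset.sum_congr rfl fun η _ => hterm i η
      _ ≤ ∑ i : Fin n → Fin p, ‖gD D ((p:ℝ)⁻¹ • (digv i + θ))‖ * B ^ k := by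
          gcongr with i _
          exact ih _ (hbox i)
      _ = fD n p D θ * B ^ k := by rw [← Finset.sum_mul]; rfl
      _ ≤ B * B ^ k := by gcongr; exact hf θ hθ
      _ = _ := by ring

lemma lat_coord {n : ℕ} (ξ : Fin n → ℤ) (i : Fin n) : |(ξ i : ℝ)| ≤ ‖lat ξ‖ := by
  have := PiLp.norm_apply_le (lat ξ) i
  simpa [lat] using this

/-- the covering of the lattice ball by `2^n` blocks -/
def cov {n P : ℕ} (x : (Fin n → Fin 2) × (Fin n → Fin P)) : Fin n → ℤ :=
  fun i => ((x.2 i : ℕ) : ℤ) - (P : ℤ) * ((x.1 i : ℕ) : ℤ)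

lemma cov_surj {n P : ℕ} (R : ℝ) (hR : R < P) (ξ : Fin n → ℤ) (h : ‖lat ξ‖ ≤ R) :
    ∃ x : (Fin n → Fin 2) × (Fin n → Fin P), cov x = ξ := by
  have hlt : ∀ i, |ξ i| < P := by
    intro i
    have := (lat_coord ξ i).trans_lt (h.trans_lt hR)
    exact_mod_cast this
  have : ∀ i, ∃ x : Fin 2 × Fin P, ((x.2 : ℕ) : ℤ) - (P : ℤ) * ((x.1 : ℕ) : ℤ) = ξ i := by
    intro i
    have h1 := abs_lt.1 (hlt i)
    rcases le_or_gt 0 (ξ i) with h0 | h0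
    · refine ⟨(0, ⟨(ξ i).toNat, by omega⟩), ?_⟩
      simp [h0]
    · refine ⟨(1, ⟨(ξ i + P).toNat, by omega⟩), ?_⟩
      simp; omega
  choose x hx using this
  exact ⟨(fun i => (x i).1, fun i => (x i).2), funext hx⟩

lemma latSum_eq {n P : ℕ} (μ : Measure (EuclideanSpace ℝ (Fin n))) (R : ℝ) (hR : R < P)
    (θ : EuclideanSpace ℝ (Fin n)) :
    latSum μ R θ = ∑ ξ ∈ Finset.univ.image (cov (n := n) (P := P)),
      if ‖lat ξ‖ ≤ R then ‖mft μ (lat ξ + θ)‖ else 0 := by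
  unfold latSum
  apply tsum_eq_sum
  intro ξ hξ
  rw [if_neg]
  intro h
  obtain ⟨x, hx⟩ := cov_surj R hR ξ h
  exact hξ (Finset.mem_image.2 ⟨x, Finset.mem_univ _, hx⟩)

lemma latSum_ge_one {n : ℕ} (μ : Measure (EuclideanSpace ℝ (Fin n))) [IsProbabilityMeasure μ]
    (R : ℝ) (hR : 0 ≤ R) : 1 ≤ latSum μ R 0 := by
  obtain ⟨P, hP⟩ := exists_nat_gt R
  rw [latSum_eq μ R hP 0]
  have hl : lat (0 : Fin n → ℤ) = 0 := by ext i; simp [lat]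
  have hm : (0 : Fin n → ℤ) ∈ Finset.univ.image (cov (n := n) (P := P)) := by
    obtain ⟨x, hx⟩ := cov_surj R hP (0 : Fin n → ℤ) (by simpa [hl] using hR)
    exact Finset.mem_image.2 ⟨x, Finset.mem_univ _, hx⟩
  refine le_trans ?_ (Finset.single_le_sum (f := fun ξ : Fin n → ℤ => if ‖lat ξ‖ ≤ R then ‖mft μ (lat ξ + 0)‖ else 0)
    (fun ξ _ => by positivity) hm)
  simp [hl, hR, mft]

lemma latSum_bound {n p : ℕ} (hp : 4 ≤ p) (D : Finset (Fin n → ℕ)) (hD : D.Nonempty)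
    (B : ℝ) (hB : 0 ≤ B) (hf : ∀ θ ∈ box01 n, fD n p D θ ≤ B)
    (lam : Measure (EuclideanSpace ℝ (Fin n)))
    (hft : ∀ ξ : EuclideanSpace ℝ (Fin n),
      mft lam ξ = ∏' j : ℕ, gD D (((p : ℝ) ^ (j + 1))⁻¹ • ξ))
    (k : ℕ) (R : ℝ) (hR : R < (p:ℝ) ^ k) (θ : EuclideanSpace ℝ (Fin n)) (hθ : θ ∈ box01 n) :
    latSum lam R θ ≤ 2 ^ n * B ^ k := by
  have hp0 : (4:ℝ) ≤ p := by exact_mod_cast hp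
  have hpp : (p:ℝ) ≠ 0 := by positivity
  rw [latSum_eq (P := p ^ k) lam R (by exact_mod_cast hR)]
  have h0 : ∀ ξ : Fin n → ℤ, 0 ≤ ‖mft lam (lat ξ + θ)‖ := fun _ => norm_nonneg _
  calc _ ≤ ∑ ξ ∈ Finset.univ.image (cov (n := n) (P := p ^ k)), ‖mft lam (lat ξ + θ)‖ := by
        apply Finset.sum_le_sum
        intro ξ _
        split_ifs
        · exact le_rfl
        · exact h0 ξ
    _ ≤ ∑ x : (Fin n → Fin 2) × (Fin n → Fin (p ^ k)), ‖mft lam (lat (cov x) + θ)‖ :=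
        Finset.sum_image_le_of_nonneg fun _ _ => h0 _
    _ ≤ ∑ x : (Fin n → Fin 2) × (Fin n → Fin (p ^ k)),
        ∏ j ∈ Finset.range k, ‖gD D (((p : ℝ) ^ (j + 1))⁻¹ • (digv x.2 + θ))‖ := by
        apply Finset.sum_le_sum
        intro x _
        rw [hft]
        refine (mft_bound hp D hD _ k).trans (le_of_eq ?_)
        refine Finset.prod_congr rfl fun j hj => ?_
        have hj' := Finset.mem_range.1 hj
        have : ((p : ℝ) ^ (j + 1))⁻¹ • (lat (cov x) + θ) = ((p : ℝ) ^ (j + 1))⁻¹ • (digv x.2 + θ)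
            + lat (fun i => -(p:ℤ) ^ (k - (j + 1)) * ((x.1 i : ℕ) : ℤ)) := by
          have hk : (p:ℝ) ^ k = p ^ (j + 1) * p ^ (k - (j + 1)) := by
            rw [← pow_add]; congr 1; omega
          ext i
          simp [lat, digv, cov, hk]
          field_simp
          ring
        rw [this, gD_periodic]
    _ = ∑ _x : Fin n → Fin 2, ∑ η : Fin n → Fin (p ^ k),
        ∏ j ∈ Finset.range k, ‖gD D (((p : ℝ) ^ (j + 1))⁻¹ • (digv η + θ))‖ := by
        rw [Fintype.sum_prod_type]
    _ ≤ ∑ _x : Fin n → Fin 2, B ^ k := Finset.sum_le_sum fun _ _ => T_bound hp D B hB hf k θ hθ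
    _ = _ := by simp

/-- if `#D = pⁿ - t` with `p ≥ 4`, then
`sup_θ f(θ) ≤ (t·pⁿ + (2p·log p)ⁿ)/(pⁿ - t)`, and consequently the missing digits measure
`λ_{p,D}` satisfies `dim_{l¹} λ_{p,D} ≥ n - log((t·pⁿ + (2p·log p)ⁿ)/(pⁿ - t))/log p`. -/
theorem statement8 (n p t : ℕ) (hn : 1 ≤ n) (hp : 4 ≤ p) (ht : 1 ≤ t)
    (D : Finset (Fin n → ℕ)) (hDdig : ∀ d ∈ D, ∀ i, d i < p)
    (hcard : D.card + t = p ^ n) (hD : D.Nonempty)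
    (lam : Measure (EuclideanSpace ℝ (Fin n))) [IsProbabilityMeasure lam]
    (hft : ∀ ξ : EuclideanSpace ℝ (Fin n),
      mft lam ξ = ∏' j : ℕ, gD D (((p : ℝ) ^ (j + 1))⁻¹ • ξ)) :
    sSup (fD n p D '' box01 n) ≤
      ((t : ℝ) * (p : ℝ) ^ n + (2 * p * Real.log p) ^ n) / ((p : ℝ) ^ n - t) ∧
    diml1 lam ≥ (n : ℝ) -
      Real.log (((t : ℝ) * (p : ℝ) ^ n + (2 * p * Real.log p) ^ n) / ((p : ℝ) ^ n - t)) /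
        Real.log p := by
  set B : ℝ := ((t : ℝ) * (p : ℝ) ^ n + (2 * p * Real.log p) ^ n) / ((p : ℝ) ^ n - t) with hBdef
  have hp0 : (4:ℝ) ≤ p := by exact_mod_cast hp
  have hlogp : 0 < Real.log p := Real.log_pos (by linarith)
  have hf : ∀ θ ∈ box01 n, fD n p D θ ≤ B := fun θ hθ => fD_bound n p t hp D hDdig hcard θ hθ
  have hB1 : 1 ≤ B := by
    have hc : (p : ℝ) ^ n - t = D.card := by
      rw [sub_eq_iff_eq_add]; exact_mod_cast hcard.symm
    have hcp : (0:ℝ) < D.card := by exact_mod_cast hD.card_pos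
    have ht' : (1:ℝ) ≤ t := by exact_mod_cast ht
    rw [hBdef, le_div_iff₀ (by rw [hc]; exact hcp)]
    have h1 : 0 ≤ (2 * p * Real.log p) ^ n := by positivity
    have h2 : (0:ℝ) ≤ (p:ℝ) ^ n := by positivity
    nlinarith
  refine ⟨Real.sSup_le ?_ (by linarith), ?_⟩
  · rintro _ ⟨θ, hθ, rfl⟩
    exact hf θ hθ
  rw [ge_iff_le]
  unfold diml1
  rcases le_or_gt ((n:ℝ) - Real.log B / Real.log p) 0 with hs | hs
  · exact hs.trans (Real.sSup_nonneg fun s hs => hs.1.le)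
  apply le_csSup
  · refine ⟨n, ?_⟩
    rintro s ⟨_, C, hC, h⟩
    by_contra! hlt
    have ht : Tendsto (fun R : ℝ => C * R ^ ((n:ℝ) - s)) atTop (𝓝 0) := by
      have := (tendsto_rpow_neg_atTop (y := s - n) (by linarith)).const_mul C
      simpa using this
    have h1 : ∀ᶠ R : ℝ in atTop, (1:ℝ) ≤ C * R ^ ((n:ℝ) - s) := by
      filter_upwards [eventually_ge_atTop 1] with R hR
      refine (latSum_ge_one lam R (by linarith)).trans (h R hR 0 ?_)
      intro i; simp
    have := ge_of_tendsto ht h1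
    linarith
  · refine ⟨hs, 2 ^ n * B, by positivity, ?_⟩
    intro R hR θ hθ
    obtain ⟨k, hk1, hk2⟩ := exists_nat_pow_near hR (by linarith : (1:ℝ) < p)
    refine (latSum_bound hp D hD B (by linarith) hf lam hft (k + 1) R hk2 θ hθ).trans ?_
    rw [sub_sub_cancel, pow_succ', ← mul_assoc]
    gcongr
    have : B = (p:ℝ) ^ (Real.log B / Real.log p) := by
      rw [Real.rpow_def_of_pos (by linarith), mul_div_cancel₀ _ hlogp.ne', Real.exp_log (by linarith)]
    calc B ^ k = ((p:ℝ) ^ k) ^ (Real.log B / Real.log p) := by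
          conv_lhs => rw [this]
          rw [← Real.rpow_natCast, ← Real.rpow_natCast, ← Real.rpow_mul (by positivity), ← Real.rpow_mul (by positivity), mul_comm]
      _ ≤ _ := by
          apply Real.rpow_le_rpow (by positivity) hk1
          exact div_nonneg (Real.log_nonneg hB1) hlogp.le
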